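/- Let n ≥ 2 and let w, w' : Fin n → ℝ be nonzero weighting vectors (non-increasing) that each sum to zero. Let E(T_w) denote the orthogonal complement of ker(T_w) in ℝ^{Perm(Fin n)} with the standard inner product, and similarly E(T_{w'}). Then E(T_w) = E(T_{w'}) if and only if w' = α·w for some α > 0; moreover, if E(T_w) ≠ E(T_{w'}), then E(T_w) ∩ E(T_{w'}) = {0}. -/

import Mathlib

/-- The positional voting map `T_w`, sending a profile `p : Perm (Fin n) → ℝ` to the
score function `c ↦ ∑ σ, p σ * w (σ⁻¹ c)`. -/
noncomputable def posMap (n : ℕ) (w : Fin n → ℝ) :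
    (Equiv.Perm (Fin n) → ℝ) →ₗ[ℝ] (Fin n → ℝ) where
  toFun p := fun c => ∑ σ : Equiv.Perm (Fin n), p σ * w (σ⁻¹ c)
  map_add' p q := by
    funext c
    simp [add_mul, Finset.sum_add_distrib]
  map_smul' a p := by
    funext c
    simp [Finset.mul_sum, mul_assoc]

/-- The effective space of a linear map `T` on profiles: the orthogonal complement of
`ker T` with respect to the standard inner product `⟨f,g⟩ = ∑ σ, f σ * g σ`. -/
def effectiveSpace (n : ℕ) (T : (Equiv.Perm (Fin n) → ℝ) →ₗ[ℝ] (Fin n → ℝ)) :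
    Submodule ℝ (Equiv.Perm (Fin n) → ℝ) where
  carrier := {f | ∀ g : Equiv.Perm (Fin n) → ℝ, T g = 0 →
    ∑ σ : Equiv.Perm (Fin n), f σ * g σ = 0}
  add_mem' := by
    intro a b ha hb g hg
    simp only [Pi.add_apply, add_mul, Finset.sum_add_distrib]
    rw [ha g hg, hb g hg, add_zero]
  zero_mem' := by
    intro g hg
    simp
  smul_mem' := by
    intro c f hf g hg
    simp only [Pi.smul_apply, smul_eq_mul, mul_assoc, ← Finset.mul_sum]
    rw [hf g hg, mul_zero]

/-- Elements of the effective space of `posMap n w` are combinations of the functions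
`σ ↦ w (σ⁻¹ c)`. -/
theorem mem_effectiveSpace_posMap_iff {n : ℕ} {w : Fin n → ℝ} {f : Equiv.Perm (Fin n) → ℝ} :
    f ∈ effectiveSpace n (posMap n w) ↔ ∃ a : Fin n → ℝ, ∀ σ, f σ = ∑ i, a (σ i) * w i := by
  constructor
  · intro hf
    let φ (v : Equiv.Perm (Fin n) → ℝ) : (Equiv.Perm (Fin n) → ℝ) →ₗ[ℝ] ℝ :=
      Fintype.linearCombination ℝ v
    have hspan : φ f ∈ Submodule.span ℝ (Set.range fun c : Fin n => φ fun σ => w (σ⁻¹ c)) := by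
      apply mem_span_of_iInf_ker_le_ker
      intro g hg
      simp only [Submodule.mem_iInf, LinearMap.mem_ker, φ, Fintype.linearCombination_apply,
        smul_eq_mul] at hg ⊢
      simpa only [mul_comm] using hf g (funext hg)
    obtain ⟨a, ha⟩ := (Submodule.mem_span_range_iff_exists_fun ℝ).1 hspan
    refine ⟨a, fun σ => ?_⟩
    have h := LinearMap.congr_fun ha (Pi.single σ 1)
    simp only [LinearMap.sum_apply, LinearMap.smul_apply, φ,
      Fintype.linearCombination_apply_single, smul_eq_mul, one_mul] at h
    rw [← h, ← Equiv.sum_comp σ]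
    simp
  · rintro ⟨a, ha⟩ g hg
    have hg' (c : Fin n) : ∑ σ, g σ * w (σ⁻¹ c) = 0 := congrFun hg c
    calc ∑ σ, f σ * g σ = ∑ σ, ∑ c, a c * (g σ * w (σ⁻¹ c)) := by
          refine Finset.sum_congr rfl fun σ _ => ?_
          rw [ha, Finset.sum_mul, ← Equiv.sum_comp σ (fun c => a c * (g σ * w (σ⁻¹ c)))]
          refine Finset.sum_congr rfl fun i _ => ?_
          rw [show σ⁻¹ (σ i) = i from σ.symm_apply_apply i]
          ring
      _ = 0 := by
          rw [Finset.sum_comm]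
          simp only [← Finset.mul_sum, hg', mul_zero, Finset.sum_const_zero]

theorem exists_perm_apply_eq_and_apply_eq {α : Type*} [DecidableEq α] {i j x y : α}
    (hij : i ≠ j) (hxy : x ≠ y) : ∃ σ : Equiv.Perm α, σ i = x ∧ σ j = y := by
  refine ⟨Equiv.swap (Equiv.swap i x j) y * Equiv.swap i x, ?_, ?_⟩
  · rw [Equiv.Perm.mul_apply, Equiv.swap_apply_left]
    refine Equiv.swap_apply_of_ne_of_ne (fun h => hij ?_) hxy
    apply (Equiv.swap i x).injective
    rw [← h, Equiv.swap_apply_left]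
  · rw [Equiv.Perm.mul_apply, Equiv.swap_apply_left]

theorem sum_perm_sub_sum_perm_mul_swap {n : ℕ} (a w : Fin n → ℝ) (σ : Equiv.Perm (Fin n))
    {i j : Fin n} (hij : i ≠ j) :
    ∑ k, a (σ k) * w k - ∑ k, a ((σ * Equiv.swap i j) k) * w k =
      (a (σ i) - a (σ j)) * (w i - w j) := by
  rw [← Finset.sum_sub_distrib, Fintype.sum_eq_add i j hij]
  · simp only [Equiv.Perm.mul_apply, Equiv.swap_apply_left, Equiv.swap_apply_right]
    ring
  · rintro k ⟨hki, hkj⟩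
    rw [Equiv.Perm.mul_apply, Equiv.swap_apply_of_ne_of_ne hki hkj, sub_self]

theorem sub_mul_sub_eq_of_sum_perm_eq {n : ℕ} {a b w w' : Fin n → ℝ}
    (h : ∀ σ : Equiv.Perm (Fin n), ∑ k, a (σ k) * w k = ∑ k, b (σ k) * w' k) {x y : Fin n}
    (hxy : x ≠ y) (i j : Fin n) :
    (a x - a y) * (w i - w j) = (b x - b y) * (w' i - w' j) := by
  obtain rfl | hij := eq_or_ne i j
  · simp
  obtain ⟨σ, rfl, rfl⟩ := exists_perm_apply_eq_and_apply_eq hij hxy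
  rw [← sum_perm_sub_sum_perm_mul_swap a w σ hij, ← sum_perm_sub_sum_perm_mul_swap b w' σ hij,
    h, h]

theorem eq_zero_of_forall_eq_of_sum_eq_zero {n : ℕ} {w : Fin n → ℝ} (hw : ∀ i j, w i = w j)
    (hwsum : ∑ c, w c = 0) : w = 0 := by
  funext i
  have hn : (n : ℝ) ≠ 0 := by exact_mod_cast i.pos.ne'
  rw [Finset.sum_congr rfl fun j _ => hw j i] at hwsum
  simpa [hn] using hwsum

theorem exists_pos_smul_eq_of_mul_eq_mul {n : ℕ} {w w' : Fin n → ℝ} {d d' : ℝ} (hd : d ≠ 0)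
    (hw0 : w ≠ 0) (hw'0 : w' ≠ 0) (hw : Antitone w) (hw' : Antitone w')
    (hwsum : ∑ c, w c = 0) (hw'sum : ∑ c, w' c = 0)
    (h : ∀ i j, d * (w i - w j) = d' * (w' i - w' j)) : ∃ α : ℝ, 0 < α ∧ w' = α • w := by
  have hmul (i : Fin n) : d * w i = d' * w' i := by
    have hn : (n : ℝ) ≠ 0 := by exact_mod_cast i.pos.ne'
    have hsum := Finset.sum_congr (rfl : Finset.univ = Finset.univ) fun j _ => h i j
    rw [← Finset.mul_sum, ← Finset.mul_sum, Finset.sum_sub_distrib, Finset.sum_sub_distrib,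
      hwsum, hw'sum] at hsum
    simp only [Finset.sum_const, Finset.card_univ, Fintype.card_fin, nsmul_eq_mul,
      sub_zero] at hsum
    apply mul_left_cancel₀ hn
    linarith
  have hd' : d' ≠ 0 := by
    rintro rfl
    refine hw0 (funext fun i => ?_)
    simpa [hd] using hmul i
  have hsmul : w' = (d / d') • w := by
    funext i
    rw [Pi.smul_apply, smul_eq_mul]
    field_simp
    linarith [hmul i]
  refine ⟨d / d', ?_, hsmul⟩
  by_contra! hneg
  have hmono : Monotone w' := by
    rw [hsmul]
    intro i j hij
    exact mul_le_mul_of_nonpos_left (hw hij) hneg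
  refine hw'0 (eq_zero_of_forall_eq_of_sum_eq_zero (fun i j => ?_) hw'sum)
  rcases le_total i j with hij | hij
  · exact le_antisymm (hmono hij) (hw' hij)
  · exact le_antisymm (hw' hij) (hmono hij)

theorem exists_pos_smul_eq_of_mem_effectiveSpace {n : ℕ} {w w' : Fin n → ℝ} (hw0 : w ≠ 0)
    (hw'0 : w' ≠ 0) (hw : Antitone w) (hw' : Antitone w') (hwsum : ∑ c, w c = 0)
    (hw'sum : ∑ c, w' c = 0) {f : Equiv.Perm (Fin n) → ℝ} (hf0 : f ≠ 0)
    (hf : f ∈ effectiveSpace n (posMap n w)) (hf' : f ∈ effectiveSpace n (posMap n w')) :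
    ∃ α : ℝ, 0 < α ∧ w' = α • w := by
  obtain ⟨a, ha⟩ := mem_effectiveSpace_posMap_iff.1 hf
  obtain ⟨b, hb⟩ := mem_effectiveSpace_posMap_iff.1 hf'
  obtain ⟨x, y, hxy⟩ : ∃ x y, a x ≠ a y := by
    by_contra! hconst
    refine hf0 (funext fun σ => ?_)
    rw [ha]
    obtain _ | n := n
    · simp
    · rw [Finset.sum_congr rfl fun i _ => by rw [hconst (σ i) 0], ← Finset.mul_sum, hwsum,
        mul_zero, Pi.zero_apply]
  exact exists_pos_smul_eq_of_mul_eq_mul (sub_ne_zero.2 hxy) hw0 hw'0 hw hw' hwsum hw'sum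
    (sub_mul_sub_eq_of_sum_perm_eq (fun σ => by rw [← ha, ← hb]) (ne_of_apply_ne a hxy))

theorem effectiveSpace_posMap_smul {n : ℕ} (w : Fin n → ℝ) {α : ℝ} (hα : α ≠ 0) :
    effectiveSpace n (posMap n (α • w)) = effectiveSpace n (posMap n w) := by
  have hker (g : Equiv.Perm (Fin n) → ℝ) : posMap n (α • w) g = 0 ↔ posMap n w g = 0 := by
    have : posMap n (α • w) g = α • posMap n w g := by
      funext c
      simp [posMap, Finset.mul_sum, mul_left_comm]
    rw [this, smul_eq_zero_iff_right hα]
  ext f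
  exact forall_congr' fun g => by rw [hker]

theorem exists_ne_zero_mem_effectiveSpace {n : ℕ} {w : Fin n → ℝ} (hw0 : w ≠ 0) :
    ∃ f ∈ effectiveSpace n (posMap n w), f ≠ 0 := by
  obtain ⟨i, hi⟩ := Function.ne_iff.1 hw0
  refine ⟨_, mem_effectiveSpace_posMap_iff.2 ⟨Pi.single i 1, fun σ => rfl⟩, fun h => hi ?_⟩
  simpa [Pi.single_apply] using congrFun h 1

/-- For nonzero non-increasing weighting vectors w, w' summing to zero,
E(T_w) = E(T_{w'}) iff w' is a positive multiple of w; and if the effective spaces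
differ, they intersect trivially. -/
theorem effective_spaces_equal_iff (n : ℕ) (hn : 2 ≤ n)
    (w w' : Fin n → ℝ) (hw0 : w ≠ 0) (hw'0 : w' ≠ 0)
    (hw : Antitone w) (hw' : Antitone w')
    (hwsum : ∑ c, w c = 0) (hw'sum : ∑ c, w' c = 0) :
    ((effectiveSpace n (posMap n w) = effectiveSpace n (posMap n w')) ↔
      ∃ α : ℝ, 0 < α ∧ w' = α • w)
    ∧ (effectiveSpace n (posMap n w) ≠ effectiveSpace n (posMap n w') →
        effectiveSpace n (posMap n w) ⊓ effectiveSpace n (posMap n w') = ⊥) := by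
  have key {f} (hf0 : f ≠ 0) (hf : f ∈ effectiveSpace n (posMap n w)) :=
    exists_pos_smul_eq_of_mem_effectiveSpace hw0 hw'0 hw hw' hwsum hw'sum hf0 hf
  have hiff : effectiveSpace n (posMap n w) = effectiveSpace n (posMap n w') ↔
      ∃ α : ℝ, 0 < α ∧ w' = α • w := by
    constructor
    · intro h
      obtain ⟨f, hf, hf0⟩ := exists_ne_zero_mem_effectiveSpace hw0
      exact key hf0 hf (h ▸ hf)
    · rintro ⟨α, hα, rfl⟩
      exact (effectiveSpace_posMap_smul w hα.ne').symm
  refine ⟨hiff, fun hne => (Submodule.eq_bot_iff _).2 fun f hf => ?_⟩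
  by_contra hf0
  exact hne (hiff.2 (key hf0 hf.1 hf.2))
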